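/- For every natural number g ≥ 1 and every natural number k, the rational number 2^g · det M(k) / ∏_{j=1}^{g} (2j)! is a nonnegative integer, where M(k) is the g × g matrix with M_{0,s} = 1 for all s and M_{r,s} = (k+1+r)^{2s+2} - (k+1-r)^{2s+2} for 1 ≤ r ≤ g-1, 0 ≤ s ≤ g-1. -/

import Mathlib

/-- The genus-`g` Verlinde matrix over ℚ: `M_{0,s} = 1` and
`M_{r,s} = (k+1+r)^{2s+2} - (k+1-r)^{2s+2}` for `r ≥ 1`. -/
def verlindeMatrix (g : ℕ) (k : ℚ) : Matrix (Fin g) (Fin g) ℚ :=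
  fun r s => if (r : ℕ) = 0 then 1
    else (k + 1 + (r : ℕ)) ^ (2 * (s : ℕ) + 2) - (k + 1 - (r : ℕ)) ^ (2 * (s : ℕ) + 2)

open PowerSeries in
/-- Inverse of a series with positive constant term and nonpositive other coefficients. -/
lemma vl_inv_nonneg (f : PowerSeries ℚ) (h0 : 0 < coeff 0 f) (h : ∀ n, coeff (n + 1) f ≤ 0) :
    ∃ K : PowerSeries ℚ, f * K = 1 ∧ ∀ n, 0 ≤ coeff n K := by
  have hc : constantCoeff f ≠ 0 := by
    rw [← coeff_zero_eq_constantCoeff_apply]; exact h0.ne'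
  refine ⟨f⁻¹, PowerSeries.mul_inv_cancel f hc, ?_⟩
  intro n
  induction n using Nat.strong_induction_on with
  | _ n ih =>
    rw [PowerSeries.coeff_inv]
    rw [coeff_zero_eq_constantCoeff_apply] at h0
    split_ifs with hn
    · exact (inv_pos.mpr h0).le
    · rw [neg_mul, ← mul_neg, ← Finset.sum_neg_distrib]
      refine mul_nonneg (inv_pos.mpr h0).le (Finset.sum_nonneg ?_)
      rintro ⟨a, b⟩ hab
      rw [Finset.HasAntidiagonal.mem_antidiagonal] at hab
      dsimp only at hab ⊢
      split_ifs with hb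
      · obtain ⟨a, rfl⟩ : ∃ a', a = a' + 1 := ⟨a - 1, by omega⟩
        have h1 := h a
        have h2 := ih b hb
        nlinarith
      · simp

/-- Chebyshev-like polynomials. -/
noncomputable def vlU : ℕ → Polynomial ℤ
  | 0 => 0
  | 1 => 1
  | (n + 2) => (2 + Polynomial.X) * vlU (n + 1) - vlU n

noncomputable def vlS (n : ℕ) : PowerSeries ℚ := ((vlU n).map (Int.castRingHom ℚ) : Polynomial ℚ)

lemma vlS_zero : vlS 0 = 0 := by simp [vlS, vlU]
lemma vlS_one : vlS 1 = 1 := by simp [vlS, vlU]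
lemma vlS_add_two (n : ℕ) : vlS (n + 2) = (2 + PowerSeries.X) * vlS (n + 1) - vlS n := by
  have h2 : ((2 : Polynomial ℚ) : PowerSeries ℚ) = 2 := by
    have := map_ofNat (Polynomial.coeToPowerSeries.ringHom (R := ℚ)) 2
    simpa using this
  simp [vlS, vlU, h2, Polynomial.coe_sub]

lemma vlS_const (n : ℕ) : PowerSeries.constantCoeff (vlS n) = n := by
  induction n using Nat.twoStepInduction with
  | zero => simp [vlS_zero]
  | one => simp [vlS_one]
  | more n h1 h2 => 
    have e2 : (2 : PowerSeries ℚ) = PowerSeries.C 2 := (map_ofNat PowerSeries.C 2).symm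
    simp [vlS_add_two, h1, h2, e2]; ring

lemma vlU_coeff_ge (n m : ℕ) (h : n ≤ m) : (vlU n).coeff m = 0 := by
  induction n using Nat.twoStepInduction generalizing m with
  | zero => simp [vlU]
  | one => rw [vlU, Polynomial.coeff_one, if_neg (by omega)]
  | more n h1 h2 =>
    obtain ⟨m, rfl⟩ : ∃ a', m = a' + 1 := ⟨m - 1, by omega⟩
    rw [vlU, add_mul, Polynomial.coeff_sub, Polynomial.coeff_add, Polynomial.coeff_X_mul,
      h1 _ (by omega), h2 m (by omega), Polynomial.coeff_ofNat_mul, h2 _ (by omega)]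
    simp

lemma vlU_coeff_top (n : ℕ) : (vlU (n + 1)).coeff n = 1 := by
  induction n with
  | zero => simp [vlU]
  | succ n ih =>
    rw [vlU, add_mul, Polynomial.coeff_sub, Polynomial.coeff_add, Polynomial.coeff_X_mul,
      Polynomial.coeff_ofNat_mul, vlU_coeff_ge _ _ le_rfl, vlU_coeff_ge n _ (by omega), ih]
    simp

noncomputable def vlE (n : ℕ) : PowerSeries ℚ := PowerSeries.rescale (-1) (vlS n)

lemma vlE_zero : vlE 0 = 0 := by simp [vlE, vlS_zero]
lemma vlE_one : vlE 1 = 1 := by simp [vlE, vlS_one]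
lemma vlE_add_two (n : ℕ) : vlE (n + 2) = (2 - PowerSeries.X) * vlE (n + 1) - vlE n := by
  simp only [vlE, vlS_add_two, map_sub, map_mul, map_add, PowerSeries.rescale_neg_one_X, map_ofNat]
  ring
lemma vlE_const (n : ℕ) : PowerSeries.constantCoeff (vlE n) = n := by
  induction n using Nat.twoStepInduction with
  | zero => simp [vlE_zero]
  | one => simp [vlE_one]
  | more n h1 h2 => 
    have e2 : (2 : PowerSeries ℚ) = PowerSeries.C 2 := (map_ofNat PowerSeries.C 2).symm
    simp [vlE_add_two, h1, h2, e2]; ring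

open PowerSeries in
lemma vl_mul_nonneg (f h : PowerSeries ℚ) (hf : ∀ n, 0 ≤ coeff n f) (hh : ∀ n, 0 ≤ coeff n h)
    (n : ℕ) : 0 ≤ coeff n (f * h) := by
  rw [coeff_mul]
  exact Finset.sum_nonneg fun _ _ => mul_nonneg (hf _) (hh _)

open PowerSeries in
lemma vlE_inv (n : ℕ) : ∃ H : PowerSeries ℚ, vlE (n + 1) * H = 1 ∧ (∀ m, 0 ≤ coeff m H) ∧
    ∀ m, 0 ≤ coeff m (vlE n * H) := by
  induction n with
  | zero => 
    refine ⟨1, by simp [vlE_one], ?_, by simp [vlE_zero]⟩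
    intro m
    rw [coeff_one]; split_ifs <;> simp
  | succ n ih =>
    obtain ⟨H, h1, h2, h3⟩ := ih
    have key : vlE (n + 2) * H = 2 - X - vlE n * H := by
      rw [vlE_add_two]; linear_combination (2 - X) * h1
    have hc : constantCoeff H * (n + 1) = 1 := by
      have := congrArg constantCoeff h1
      rw [map_mul, vlE_const] at this
      push_cast at this
      simpa [mul_comm] using this
    have hH : constantCoeff H = 1 / (n + 1 : ℚ) := by
      rw [eq_div_iff (by positivity), hc]
    obtain ⟨K, hK1, hK2⟩ := vl_inv_nonneg (vlE (n + 2) * H) (by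
      rw [coeff_zero_eq_constantCoeff_apply, map_mul, vlE_const, hH]; positivity) (by
      intro m
      rw [key, map_sub, map_sub]
      have e : coeff (m + 1) (2 : PowerSeries ℚ) = 0 := by
        have : (2 : PowerSeries ℚ) = C 2 := (map_ofNat C 2).symm
        rw [this, coeff_C]; simp
      have := h3 (m + 1)
      have hX : 0 ≤ coeff (m + 1) (X : PowerSeries ℚ) := by
        rw [coeff_X]; split_ifs <;> simp
      linarith)
    refine ⟨H * K, by rw [← hK1, mul_assoc], vl_mul_nonneg _ _ h2 hK2, ?_⟩
    rw [← mul_assoc, h1, one_mul]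
    exact hK2

open PowerSeries in
lemma vl_B (n : ℕ) : ∃ B : PowerSeries ℚ, B * ((X + 4) * vlS (n + 1)) = 1 ∧
    ∀ m, 0 ≤ (-1) ^ m * coeff m B := by
  obtain ⟨H, h1, h2, -⟩ := vlE_inv n
  have e4 : (4 : PowerSeries ℚ) = C 4 := (map_ofNat C 4).symm
  obtain ⟨K, hK1, hK2⟩ := vl_inv_nonneg (4 - X) (by rw [e4]; simp) (by
    intro m
    rw [e4, map_sub, coeff_C, coeff_X]
    split_ifs <;> simp_all)
  refine ⟨rescale (-1) (K * H), ?_, ?_⟩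
  · have h := congrArg (rescale (-1 : ℚ)) (show (K * H) * ((4 - X) * vlE (n + 1)) = 1 by
      linear_combination (4 - X) * K * h1 + hK1)
    have hr : rescale (-1 : ℚ) (vlE (n + 1)) = vlS (n + 1) := by
      rw [vlE, rescale_rescale]; simp
    rw [map_mul, map_mul (rescale (-1 : ℚ)) (4 - X), hr, map_one, map_sub,
      rescale_neg_one_X, map_ofNat] at h
    rw [← h]; ring
  · intro m
    rw [coeff_rescale, ← mul_assoc, ← mul_pow]
    simpa using vl_mul_nonneg _ _ hK2 h2 m

/-- The product `y² (y²-1) ... (y²-(j-1)²)`. -/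
def vlq (j : ℕ) (y : ℚ) : ℚ := ∏ l ∈ Finset.range j, (y ^ 2 - (l : ℚ) ^ 2)

lemma vlq_succ (j : ℕ) (y : ℚ) : vlq (j + 1) y = vlq j y * (y ^ 2 - (j : ℚ) ^ 2) := by
  rw [vlq, Finset.prod_range_succ]; rfl

lemma vlq_neg (j : ℕ) (y : ℚ) : vlq j (-y) = vlq j y := by simp [vlq]

lemma vlq_shift (j : ℕ) (y : ℚ) :
    vlq (j + 1) (y + 1) * y = vlq j y * ((y + 1) * (y + j) * (y + j + 1)) := by
  induction j with
  | zero => simp [vlq]; ring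
  | succ j ih =>
    rw [vlq_succ (j + 1), vlq_succ j y]
    push_cast
    linear_combination ((y + 1) ^ 2 - ((j : ℚ) + 1) ^ 2) * ih

lemma vlq_shift' (j : ℕ) (y : ℚ) :
    vlq (j + 1) (y - 1) * y = vlq j y * ((y - 1) * (y - j) * (y - j - 1)) := by
  have := vlq_shift j (-y)
  rw [vlq_neg, show -y + 1 = -(y - 1) by ring, vlq_neg] at this
  linear_combination -this

lemma vlq_one (j : ℕ) : vlq (j + 2) 1 = 0 := by
  rw [vlq, Finset.prod_eq_zero (i := 1)] <;> simp

lemma vlq_zero' (j : ℕ) : vlq (j + 1) 0 = 0 := by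
  rw [vlq, Finset.prod_eq_zero (i := 0)] <;> simp

lemma vlq_diff (j : ℕ) (y : ℚ) : vlq (j + 1) (y + 1) + vlq (j + 1) (y - 1) =
    2 * vlq (j + 1) y + (2 * j + 2) * (2 * j + 1) * vlq j y := by
  by_cases hy : y = 0
  · subst hy
    rw [zero_sub, vlq_neg, zero_add, vlq_zero']
    rcases j with _ | j
    · simp [vlq]; norm_num
    · rw [vlq_one, vlq_zero']; simp
  · apply mul_right_cancel₀ hy
    rw [vlq_succ j y]
    linear_combination vlq_shift j y + vlq_shift' j y

noncomputable def vlW (y : ℚ) : PowerSeries ℚ :=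
  PowerSeries.mk fun j => 2 * vlq j y / (Nat.factorial (2 * j) : ℚ)

open PowerSeries in
lemma vlW_rec (y : ℚ) : vlW (y + 1) + vlW (y - 1) = (2 + X) * vlW y := by
  have e2 : (2 : PowerSeries ℚ) = C 2 := (map_ofNat C 2).symm
  ext j
  rw [add_mul, map_add, map_add, e2, coeff_C_mul]
  rcases j with _ | j
  · simp [vlW, vlq]; norm_num
  · rw [coeff_succ_X_mul]
    simp only [vlW, coeff_mk]
    have hf : (Nat.factorial (2 * (j + 1)) : ℚ) =
        (2 * j + 2) * (2 * j + 1) * (Nat.factorial (2 * j) : ℚ) := by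
      rw [show 2 * (j + 1) = 2 * j + 1 + 1 by ring, Nat.factorial_succ, Nat.factorial_succ]
      push_cast; ring
    have h0 : (Nat.factorial (2 * j) : ℚ) ≠ 0 := by positivity
    have h1 : (2 * j + 2 : ℚ) ≠ 0 := by positivity
    have h2 : (2 * j + 1 : ℚ) ≠ 0 := by positivity
    rw [hf]
    field_simp
    linear_combination vlq_diff j y

lemma vlW_neg (y : ℚ) : vlW (-y) = vlW y := by simp [vlW, vlq_neg]

open PowerSeries in
lemma vlW_zero : vlW 0 = 2 := by
  have e2 : (2 : PowerSeries ℚ) = C 2 := (map_ofNat C 2).symm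
  ext j
  rw [e2, coeff_C]
  rcases j with _ | j
  · simp [vlW, vlq]
  · simp [vlW, vlq_zero']

open PowerSeries in
lemma vlW_one : vlW 1 = 2 + X := by
  have h := vlW_rec 0
  rw [zero_sub, vlW_neg, zero_add, vlW_zero] at h
  have e2 : (2 : PowerSeries ℚ) ≠ 0 := by
    rw [show (2 : PowerSeries ℚ) = C 2 from (map_ofNat C 2).symm]
    intro h
    simpa using congrArg constantCoeff h
  apply mul_left_cancel₀ e2
  linear_combination h

open PowerSeries in
lemma vlW_sub (y : ℚ) (r : ℕ) :
    vlW (y + r) - vlW (y - r) = vlS r * (vlW (y + 1) - vlW (y - 1)) := by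
  induction r using Nat.twoStepInduction with
  | zero => simp [vlS_zero]
  | one => simp [vlS_one]
  | more r h1 h2 =>
    have a := vlW_rec (y + (r + 1))
    have b := vlW_rec (y - (r + 1))
    rw [show y + (r + 1) + 1 = y + (r + 2 : ℚ) by ring,
      show y + (r + 1) - 1 = y + (r : ℚ) by ring] at a
    rw [show y - (r + 1) + 1 = y - (r : ℚ) by ring,
      show y - (r + 1) - 1 = y - (r + 2 : ℚ) by ring] at b
    rw [vlS_add_two]
    push_cast at *
    linear_combination a - b - h1 + (2 + X) * h2

open PowerSeries in
lemma vlW_diff (n : ℕ) : vlW (n + 1) - vlW (n - 1) = X * (X + 4) * vlS n := by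
  have h := vlW_sub 1 n
  have h2 : vlW (1 + 1) - vlW (1 - 1) = X * (X + 4) := by
    have := vlW_rec 1
    rw [sub_self, vlW_zero] at *
    rw [vlW_one] at this
    linear_combination this
  rw [h2, ← vlW_neg (1 - n)] at h
  rw [show (n : ℚ) + 1 = 1 + n by ring, show (n : ℚ) - 1 = -(1 - n) by ring]
  linear_combination h

open PowerSeries in
lemma vlW_main (n r : ℕ) : vlW (n + r) - vlW (n - r) = X * (vlS r * ((X + 4) * vlS n)) := by
  rw [vlW_sub, vlW_diff]; ring

open PowerSeries in
/-- The Toeplitz factorisation. -/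
lemma vl_det_coeff (G : ℕ) (A B : PowerSeries ℚ) :
    (Matrix.of fun (i j : Fin (G + 1)) =>
      coeff (j : ℕ) ((if (i : ℕ) = 0 then B else vlS i) * A)).det
      = (-1) ^ G * coeff G B * (coeff 0 A) ^ (G + 1) := by
  set f : ℕ → PowerSeries ℚ := fun i => if i = 0 then B else vlS i with hf
  let R : Matrix (Fin (G + 1)) (Fin (G + 1)) ℚ := Matrix.of fun i m => coeff (m : ℕ) (f i)
  let T : Matrix (Fin (G + 1)) (Fin (G + 1)) ℚ :=
    Matrix.of fun m j => if (m : ℕ) ≤ j then coeff ((j : ℕ) - m) A else 0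
  have h1 : (Matrix.of fun (i j : Fin (G + 1)) => coeff (j : ℕ) (f i * A)) = R * T := by
    ext i j
    simp only [Matrix.mul_apply, R, T, Matrix.of_apply]
    rw [coeff_mul, Finset.Nat.sum_antidiagonal_eq_sum_range_succ_mk]
    rw [Fin.sum_univ_eq_sum_range (fun m => coeff m (f i) *
      (if m ≤ (j : ℕ) then coeff ((j : ℕ) - m) A else 0)) (G + 1)]
    have hsub : Finset.range ((j : ℕ) + 1) ⊆ Finset.range (G + 1) := by
      intro x hx; simp only [Finset.mem_range] at *; omega
    rw [← Finset.sum_subset hsub]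
    · refine Finset.sum_congr rfl fun x hx => ?_
      rw [Finset.mem_range] at hx
      rw [if_pos (by omega)]
    · intro x _ hx
      rw [Finset.mem_range] at hx
      rw [if_neg (by omega), mul_zero]
  have hT : T.det = (coeff 0 A) ^ (G + 1) := by
    rw [Matrix.det_of_isUpperTriangular]
    · simp [T]
    · intro i j hij
      have : (j : ℕ) < i := hij
      simp only [T, Matrix.of_apply]
      rw [if_neg (by omega)]
  have hS : ∀ i m : ℕ, coeff m (vlS i) = ((vlU i).coeff m : ℚ) := by
    intro i m; simp [vlS]
  have hR : R.det = (-1) ^ G * coeff G B := by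
    rw [Matrix.det_succ_column R (Fin.last G), Finset.sum_eq_single 0]
    · have hsub : (R.submatrix (Fin.succAbove 0) (Fin.succAbove (Fin.last G))).det = 1 := by
        rw [Matrix.det_of_isLowerTriangular]
        · refine Finset.prod_eq_one fun i _ => ?_
          simp [R, f, hS, vlU_coeff_top]
        · intro i j hij
          have hij : (i : ℕ) < j := hij
          simp [R, f, hS]
          exact vlU_coeff_ge _ _ (by omega)
      rw [hsub]
      simp [R, f]
    · intro i _ hi
      have hi' : (i : ℕ) ≠ 0 := fun h => hi (Fin.ext h)
      have : R i (Fin.last G) = 0 := by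
        have := vlU_coeff_ge i G (by omega)
        simp only [R, f, Matrix.of_apply, if_neg hi', hS, Fin.val_last, this, Int.cast_zero]
      rw [this]; simp
    · simp
  rw [h1, Matrix.det_mul, hT, hR]

noncomputable def vlP (j : ℕ) : Polynomial ℚ :=
  ∏ l ∈ Finset.range j, (Polynomial.X - Polynomial.C (((l : ℚ) + 1) ^ 2))

lemma vlP_eval (j : ℕ) (y : ℚ) : y ^ 2 * (vlP j).eval (y ^ 2) = vlq (j + 1) y := by
  rw [vlq, Finset.prod_range_succ', vlP, Polynomial.eval_prod]
  simp [mul_comm]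

lemma vlP_monic (j : ℕ) : (vlP j).Monic :=
  Polynomial.monic_prod_of_monic _ _ fun _ _ => Polynomial.monic_X_sub_C _

lemma vlP_deg (j : ℕ) : (vlP j).natDegree = j := by
  rw [vlP, Polynomial.natDegree_prod_of_monic _ _ fun _ _ => Polynomial.monic_X_sub_C _]
  simp only [Polynomial.natDegree_X_sub_C, Finset.sum_const, Finset.card_range, smul_eq_mul,
    mul_one]

lemma vl_prod_Icc (n : ℕ) (f : ℕ → ℚ) :
    ∏ j ∈ Finset.Icc 1 n, f j = ∏ j ∈ Finset.range n, f (j + 1) := by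
  induction n with
  | zero => simp
  | succ n ih => rw [Finset.prod_Icc_succ_top (by omega), Finset.prod_range_succ, ih]

open PowerSeries in
lemma vl_det_M (G k : ℕ) (B : PowerSeries ℚ) (hB : B * ((X + 4) * vlS (k + 1)) = 1) :
    2 ^ (G + 1) * (verlindeMatrix (G + 1) (k : ℚ)).det /
        (∏ j ∈ Finset.Icc 1 (G + 1), (Nat.factorial (2 * j) : ℚ)) =
    (Matrix.of fun (i j : Fin (G + 1)) =>
      coeff (j : ℕ) ((if (i : ℕ) = 0 then B else vlS i) * ((X + 4) * vlS (k + 1)))).det := by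
  let T : Matrix (Fin (G + 1)) (Fin (G + 1)) ℚ := Matrix.of fun i j => (vlP j).coeff i
  have hT : T.det = 1 :=
    Matrix.det_matrixOfPolynomials (fun j : Fin (G + 1) => vlP j) (fun j => vlP_deg j)
      (fun j => vlP_monic j)
  have hsum : ∀ (y : ℚ) (j : Fin (G + 1)),
      ∑ s : Fin (G + 1), y ^ (2 * (s : ℕ) + 2) * (vlP j).coeff s = vlq (j + 1) y := by
    intro y j
    rw [← vlP_eval, Polynomial.eval_eq_sum_range' (n := G + 1) (by rw [vlP_deg]; exact j.2),
      Finset.mul_sum, ← Fin.sum_univ_eq_sum_range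
        (fun s => y ^ 2 * ((vlP j).coeff s * (y ^ 2) ^ s))]
    refine Finset.sum_congr rfl fun s _ => ?_
    rw [← pow_mul]; ring
  have hN : (Matrix.of fun (i j : Fin (G + 1)) =>
      coeff (j : ℕ) ((if (i : ℕ) = 0 then B else vlS i) * ((X + 4) * vlS (k + 1)))) =
      Matrix.of fun i j : Fin (G + 1) => (2 / (Nat.factorial (2 * ((j : ℕ) + 1)) : ℚ)) *
        (verlindeMatrix (G + 1) (k : ℚ) * T) i j := by
    ext i j
    simp only [Matrix.of_apply, Matrix.mul_apply, T, verlindeMatrix]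
    by_cases hi : (i : ℕ) = 0
    · simp only [hi, if_true]
      have h := hsum 1 j
      simp only [one_pow] at h
      rw [h, hB]
      have h1 := congrArg (coeff ((j : ℕ) + 1)) vlW_one
      have e2 : (2 : PowerSeries ℚ) = C 2 := (map_ofNat C 2).symm
      rw [e2, map_add, coeff_C, coeff_X] at h1
      simp only [vlW, coeff_mk] at h1
      rw [coeff_one, div_mul_eq_mul_div, h1]
      simp
    · simp only [hi, if_false, sub_mul, Finset.sum_sub_distrib]
      rw [hsum, hsum]
      have h1 := congrArg (coeff ((j : ℕ) + 1)) (vlW_main (k + 1) i)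
      rw [coeff_succ_X_mul] at h1
      rw [← h1]
      simp only [vlW, coeff_mk, map_sub]
      push_cast
      ring
  rw [hN, Matrix.det_mul_row, Matrix.det_mul, hT, mul_one,
    Fin.prod_univ_eq_prod_range (fun j => 2 / (Nat.factorial (2 * (j + 1)) : ℚ)),
    Finset.prod_div_distrib, Finset.prod_const, Finset.card_range,
    vl_prod_Icc]
  ring

theorem verlinde_number_is_nonneg_integer (g : ℕ) (hg : 1 ≤ g) (k : ℕ) :
    ∃ m : ℕ, (m : ℚ) =
      2 ^ g * (verlindeMatrix g (k : ℚ)).det /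
        (∏ j ∈ Finset.Icc 1 g, (Nat.factorial (2 * j) : ℚ)) := by
  obtain ⟨G, rfl⟩ : ∃ G, g = G + 1 := ⟨g - 1, by omega⟩
  obtain ⟨B, hB, hpos⟩ := vl_B k
  rw [vl_det_M G k B hB]
  have hnn : 0 ≤ (Matrix.of fun (i j : Fin (G + 1)) => PowerSeries.coeff (j : ℕ)
      ((if (i : ℕ) = 0 then B else vlS i) * ((PowerSeries.X + 4) * vlS (k + 1)))).det := by
    rw [vl_det_coeff]
    refine mul_nonneg (hpos G) (pow_nonneg ?_ _)
    rw [PowerSeries.coeff_zero_eq_constantCoeff_apply, map_mul, vlS_const,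
      show (4 : PowerSeries ℚ) = PowerSeries.C 4 from (map_ofNat PowerSeries.C 4).symm]
    simp
    positivity
  let Z : Matrix (Fin (G + 1)) (Fin (G + 1)) ℤ := Matrix.of fun i j =>
    if (i : ℕ) = 0 then (if (j : ℕ) = 0 then 1 else 0) else
      (vlU i * ((Polynomial.X + 4) * vlU (k + 1))).coeff j
  have hZ : (Matrix.of fun (i j : Fin (G + 1)) => PowerSeries.coeff (j : ℕ)
      ((if (i : ℕ) = 0 then B else vlS i) * ((PowerSeries.X + 4) * vlS (k + 1)))) =
      (Int.castRingHom ℚ).mapMatrix Z := by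
    ext i j
    simp only [Matrix.of_apply, RingHom.mapMatrix_apply, Matrix.map_apply, Z]
    by_cases hi : (i : ℕ) = 0
    · simp only [hi, if_true]
      rw [hB, PowerSeries.coeff_one]
      split_ifs <;> simp
    · simp only [hi, if_false]
      have h4 : ((4 : Polynomial ℚ) : PowerSeries ℚ) = 4 := by
        have := map_ofNat (Polynomial.coeToPowerSeries.ringHom (R := ℚ)) 4
        simpa using this
      rw [← Polynomial.coeff_map, ← Polynomial.coeff_coe]
      simp [vlS, h4]
  rw [hZ, ← RingHom.map_det, eq_intCast] at hnn ⊢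
  have h0 : 0 ≤ Z.det := by exact_mod_cast hnn
  refine ⟨Z.det.toNat, ?_⟩
  have := Int.toNat_of_nonneg h0
  exact_mod_cast this
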